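/- The inverse limit ring A_ℤ(∞,m) := ⊕_{a∈ℕ^m} lim_← A_ℤ(n,m,a)^{S_n} is a polynomial ring over ℤ, freely generated by the limits of the elements e_i(μ), where i ∈ ℕ, i ≥ 1, and μ ranges over the primitive monomials of positive degree in y_1,...,y_m; equivalently, the multigraded ring homomorphism from ℤ[e_{i,μ} : i≥1, μ primitive] sending e_{i,μ} ↦ e_i(μ) is an isomorphism. -/

import Mathlib

open MvPolynomial Finset
open scoped Classical

noncomputable section

variable {R : Type*} [CommRing R]

/-- f(j): substitution y_i ↦ x_i(j). -/
def subst (m n : ℕ) (f : MvPolynomial (Fin m) R) (j : Fin n) :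
    MvPolynomial (Fin m × Fin n) R :=
  rename (fun i => (i, j)) f

/-- the action of σ ∈ Sₙ on A_R(n,m). -/
def permRename (m n : ℕ) (σ : Equiv.Perm (Fin n)) :
    MvPolynomial (Fin m × Fin n) R →ₐ[R] MvPolynomial (Fin m × Fin n) R :=
  rename (fun q => (q.1, σ q.2))

/-- invariant submodule A_R(n,m)^{Sₙ}. -/
def invSub (R : Type*) [CommRing R] (m n : ℕ) :
    Submodule R (MvPolynomial (Fin m × Fin n) R) where
  carrier := {p | ∀ σ : Equiv.Perm (Fin n), permRename m n σ p = p}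
  add_mem' := fun ha hb σ => by simp [map_add, ha σ, hb σ]
  zero_mem' := fun σ => by simp
  smul_mem' := fun c p hp σ => by simp [map_smul, hp σ]

/-- invariant subalgebra A_R(n,m)^{Sₙ}. -/
def invAlg (R : Type*) [CommRing R] (m n : ℕ) :
    Subalgebra R (MvPolynomial (Fin m × Fin n) R) where
  carrier := {p | ∀ σ : Equiv.Perm (Fin n), permRename m n σ p = p}
  add_mem' := fun ha hb σ => by simp [map_add, ha σ, hb σ]
  mul_mem' := fun ha hb σ => by simp [map_mul, ha σ, hb σ]
  algebraMap_mem' := fun r σ => by simp [permRename]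

/-- e_α(f): coefficient of t^α in ∏ᵢ (1 + ∑ₕ tₕ fₕ(i)). -/
def eAlpha (m n : ℕ) {ι : Type*} [Fintype ι] (f : ι → MvPolynomial (Fin m) R) (α : ι → ℕ) :
    MvPolynomial (Fin m × Fin n) R :=
  coeff (Finsupp.equivFunOnFinite.symm α)
    (∏ i : Fin n, (1 + ∑ h : ι, X h * C (subst m n (f h) i)))

/-- k-th elementary symmetric polynomial evaluated at v(1),…,v(n). -/
def esymVal {S : Type*} [CommRing S] (n : ℕ) (v : Fin n → S) (k : ℕ) : S :=
  ∑ A ∈ Finset.powersetCard k (Finset.univ : Finset (Fin n)), ∏ j ∈ A, v j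

/-- multidegree of a monomial exponent. -/
def wdeg (m n : ℕ) (d : Fin m × Fin n →₀ ℕ) : Fin m → ℕ := fun i => ∑ j : Fin n, d (i, j)

/-- multidegree-a component of A_R(n,m). -/
def comp (R : Type*) [CommRing R] (m n : ℕ) (a : Fin m → ℕ) :
    Submodule R (MvPolynomial (Fin m × Fin n) R) where
  carrier := {p | ∀ d ∈ p.support, wdeg m n d = a}
  add_mem' := fun ha hb d hd => by
    rcases Finset.mem_union.1 (MvPolynomial.support_add hd) with h | h
    · exact ha d h
    · exact hb d h
  zero_mem' := fun d hd => by simp at hd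
  smul_mem' := fun c p hp d hd => hp d (MvPolynomial.support_smul hd)

/-- the restriction map πₙ₊₁ : A_R(n+1,m) → A_R(n,m), x_i(n+1) ↦ 0. -/
def projDown (R : Type*) [CommRing R] (m n : ℕ) :
    MvPolynomial (Fin m × Fin (n+1)) R →ₐ[R] MvPolynomial (Fin m × Fin n) R :=
  aeval (fun p : Fin m × Fin (n+1) =>
    if h : (p.2 : ℕ) < n then X (p.1, ⟨p.2, h⟩) else 0)

/-- e_α for finitely supported α : M_m⁺ → ℕ. -/
def eAlphaM (R : Type*) [CommRing R] (m n : ℕ) (α : {d : Fin m →₀ ℕ // d ≠ 0} →₀ ℕ) :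
    MvPolynomial (Fin m × Fin n) R :=
  eAlpha m n (fun l => monomial ((α.support.equivFin.symm l) : {d : Fin m →₀ ℕ // d ≠ 0}).1 (1 : R))
    (fun l => α (α.support.equivFin.symm l))

/-- a monomial of positive degree is primitive if it is not a proper power. -/
def Primitive (m : ℕ) (d : Fin m →₀ ℕ) : Prop :=
  d ≠ 0 ∧ ∀ (e : Fin m →₀ ℕ) (k : ℕ), 2 ≤ k → d ≠ k • e


/-- the ℤ-algebra map from the polynomial ring ℤ[e_{i,μ} : i ≥ 1, μ primitive] into the
product Π n, A_ℤ(n,m), sending e_{i,μ} to the compatible family (e_i(μ))ₙ. -/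
def sigmaMap (m : ℕ) :
    MvPolynomial {p : ℕ × (Fin m →₀ ℕ) // 1 ≤ p.1 ∧ Primitive m p.2} ℤ →ₐ[ℤ]
      (Π n : ℕ, MvPolynomial (Fin m × Fin n) ℤ) :=
  aeval (fun g => (fun n => esymVal n (fun j => subst m n (monomial g.1.2 (1 : ℤ)) j) g.1.1))

/-! ### primitive monomials -/

abbrev PrimM (m : ℕ) := {μ : Fin m →₀ ℕ // Primitive m μ}

lemma prim_gcd {m : ℕ} {μ : Fin m →₀ ℕ} (h : Primitive m μ) : (univ.gcd fun i => μ i) = 1 := by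
  obtain ⟨h0, h1⟩ := h
  have hg0 : (univ.gcd fun i => μ i) ≠ 0 := by
    intro hg
    apply h0
    ext i
    exact (Finset.gcd_eq_zero_iff.1 hg) i (mem_univ i)
  by_contra hne
  refine h1 (Finsupp.equivFunOnFinite.symm fun i => μ i / univ.gcd fun i => μ i)
    (univ.gcd fun i => μ i) (by omega) ?_
  ext i
  simp only [Finsupp.smul_apply, Finsupp.equivFunOnFinite_symm_apply_apply, smul_eq_mul]
  exact (Nat.mul_div_cancel' (Finset.gcd_dvd (mem_univ i))).symm

lemma prim_exists {m : ℕ} (v : Fin m → ℕ) (hv : v ≠ 0) :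
    ∃ (μ : PrimM m) (t : ℕ), ∀ i, v i = (t + 1) * μ.1 i := by
  obtain ⟨i0, hi0⟩ := Function.ne_iff.1 hv
  set g := univ.gcd v with hg
  have hg0 : g ≠ 0 := fun h => hi0 (Finset.gcd_eq_zero_iff.1 h i0 (mem_univ _))
  have h1 : (univ.gcd fun j => v j / univ.gcd v) = 1 := Finset.gcd_div_eq_one (mem_univ i0) hi0
  have hmul : ∀ i, v i = g * (v i / g) := fun i =>
    (Nat.mul_div_cancel' (Finset.gcd_dvd (mem_univ i))).symm
  refine ⟨⟨Finsupp.equivFunOnFinite.symm fun i => v i / g, ?_, ?_⟩, g - 1, ?_⟩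
  · intro h
    have := DFunLike.congr_fun h i0
    simp only [Finsupp.equivFunOnFinite_symm_apply_apply, Finsupp.coe_zero, Pi.zero_apply] at this
    apply hi0
    rw [hmul i0, this]; simp
  · intro e k hk h
    have : k ∣ univ.gcd fun j => v j / univ.gcd v := by
      apply Finset.dvd_gcd
      intro i _
      have := DFunLike.congr_fun h i
      simp only [Finsupp.equivFunOnFinite_symm_apply_apply, Finsupp.smul_apply, smul_eq_mul] at this
      rw [← hg, this]
      exact dvd_mul_right _ _
    rw [h1] at this
    have := Nat.le_of_dvd one_pos this
    omega
  · intro i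
    have : g - 1 + 1 = g := by omega
    rw [this]
    exact hmul i

lemma prim_unique {m : ℕ} (μ ν : PrimM m) (a b : ℕ) (ha : 0 < a)
    (h : ∀ i, a * μ.1 i = b * ν.1 i) : μ = ν ∧ a = b := by
  have h1 : (univ.gcd fun i => a * μ.1 i) = a := by
    rw [Finset.gcd_mul_left, prim_gcd μ.2]; simp
  have h2 : (univ.gcd fun i => b * ν.1 i) = b := by
    rw [Finset.gcd_mul_left, prim_gcd ν.2]; simp
  have hab : a = b := by
    rw [← h1, ← h2]
    exact Finset.gcd_congr rfl fun i _ => h i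
  subst hab
  refine ⟨?_, rfl⟩
  ext i
  exact Nat.eq_of_mul_eq_mul_left ha (h i)

lemma prim_ne {m : ℕ} (μ : PrimM m) : ∃ i, μ.1 i ≠ 0 := by
  by_contra h
  push Not at h
  exact μ.2.1 (Finsupp.ext h)

/-! ### the norm -/

def evec {m : ℕ} (v : Fin m → ℕ) : EuclideanSpace ℝ (Fin m) := WithLp.toLp 2 fun i => (v i : ℝ)

lemma evec_sameRay {m : ℕ} (μ ν : PrimM m) (h : SameRay ℝ (evec μ.1) (evec ν.1)) : μ = ν := by
  have hne : ∀ κ : PrimM m, evec κ.1 ≠ 0 := by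
    intro κ hκ
    obtain ⟨i, hi⟩ := prim_ne κ
    have := congrArg (fun w : EuclideanSpace ℝ (Fin m) => w i) hκ
    simp [evec] at this
    exact hi this
  obtain ⟨r, s, hr, hs, hrs⟩ := h.exists_pos (hne μ) (hne ν)
  have hc : ∀ i, r * (μ.1 i : ℝ) = s * (ν.1 i : ℝ) := by
    intro i
    have := congrArg (fun w : EuclideanSpace ℝ (Fin m) => w i) hrs
    simpa [evec] using this
  obtain ⟨i, hi⟩ := prim_ne ν
  refine (prim_unique μ ν (ν.1 i) (μ.1 i) (Nat.pos_of_ne_zero hi) ?_).1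
  intro l
  have h1 := hc i
  have h2 := hc l
  have : ((ν.1 i : ℝ) * μ.1 l) = μ.1 i * ν.1 l := by
    have : r * ((ν.1 i : ℝ) * μ.1 l) = r * (μ.1 i * ν.1 l) := by
      linear_combination (ν.1 i : ℝ) * h2 - (ν.1 l : ℝ) * h1
    exact mul_left_cancel₀ hr.ne' this
  exact_mod_cast this

lemma norm_sum_eq_sameRay {ι E : Type*} [NormedAddCommGroup E] [NormedSpace ℝ E]
    [StrictConvexSpace ℝ E] (s : Finset ι) (v : ι → E)
    (h : ‖∑ q ∈ s, v q‖ = ∑ q ∈ s, ‖v q‖) (a b : ι) (ha : a ∈ s) (hb : b ∈ s) :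
    SameRay ℝ (v a) (v b) := by
  by_cases hab : a = b
  · subst hab; exact SameRay.refl _
  rw [sameRay_iff_norm_add]
  apply le_antisymm (norm_add_le _ _)
  have hb' : b ∈ s.erase a := mem_erase.2 ⟨fun h => hab h.symm, hb⟩
  rw [← Finset.add_sum_erase s _ ha, ← Finset.add_sum_erase s _ ha,
    ← Finset.add_sum_erase _ _ hb', ← Finset.add_sum_erase _ _ hb', ← add_assoc, ← add_assoc] at h
  have h1 := norm_add_le (v a + v b) (∑ x ∈ (s.erase a).erase b, v x)
  have h2 := norm_sum_le ((s.erase a).erase b) v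
  linarith

/-! ### configurations -/

section config

variable {m n : ℕ} {ι : Type} [Fintype ι]

/-- exponent obtained from a configuration of subsets. -/
def dB (μ : ι → PrimM m) (B : ι → Finset (Fin n)) : Fin m × Fin n →₀ ℕ :=
  ∑ q, ∑ j ∈ B q, Finsupp.mapDomain (fun i => (i, j)) (μ q).1

lemma mapDomain_col (μ : Fin m →₀ ℕ) (j j' : Fin n) (i : Fin m) :
    Finsupp.mapDomain (fun i => (i, j)) μ (i, j') = if j = j' then μ i else 0 := by
  split_ifs with h
  · subst h
    exact Finsupp.mapDomain_apply (f := fun i => (i, j)) (fun a b hab => (Prod.ext_iff.1 hab).1) μ i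
  · apply Finsupp.mapDomain_notin_range
    rintro ⟨x, hx⟩
    exact h (Prod.ext_iff.1 hx).2

lemma dB_apply (μ : ι → PrimM m) (B : ι → Finset (Fin n)) (i : Fin m) (j : Fin n) :
    dB μ B (i, j) = ∑ q with j ∈ B q, (μ q).1 i := by
  simp only [dB, Finsupp.finset_sum_apply, mapDomain_col, Finset.sum_ite_eq', Finset.sum_filter]

def phi (d : Fin m × Fin n →₀ ℕ) : ℝ := ∑ j, ‖evec fun i => d (i, j)‖
def psi (d : Fin m × Fin n →₀ ℕ) : ℕ := ∑ j, ∑ i, d (i, j) ^ 2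
def Phi (μ : ι → PrimM m) (κ : ι → ℕ) : ℝ := ∑ q, κ q * ‖evec (μ q).1‖
def Psi (μ : ι → PrimM m) (κ : ι → ℕ) : ℕ :=
  ∑ q, ∑ q', if μ q = μ q' then min (κ q) (κ q') * ∑ i, (μ q).1 i ^ 2 else 0

def Nice1 (μ : ι → PrimM m) (B : ι → Finset (Fin n)) : Prop :=
  ∀ q q' j, j ∈ B q → j ∈ B q' → μ q = μ q'
def Nice2 (μ : ι → PrimM m) (B : ι → Finset (Fin n)) : Prop :=
  ∀ q q', μ q = μ q' → B q ⊆ B q' ∨ B q' ⊆ B q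

lemma evec_dB (μ : ι → PrimM m) (B : ι → Finset (Fin n)) (j : Fin n) :
    (evec fun i => dB μ B (i, j)) = ∑ q with j ∈ B q, evec (μ q).1 := by
  ext i
  simp [evec, dB_apply]

lemma Phi_eq (μ : ι → PrimM m) (κ : ι → ℕ) (B : ι → Finset (Fin n)) (hB : ∀ q, #(B q) = κ q) :
    Phi μ κ = ∑ j : Fin n, ∑ q with j ∈ B q, ‖evec (μ q).1‖ := by
  simp only [Finset.sum_filter]
  rw [Finset.sum_comm]
  simp only [Phi]
  refine Finset.sum_congr rfl fun q _ => ?_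
  rw [← Finset.sum_filter]
  simp [hB]

lemma phi_le (μ : ι → PrimM m) (κ : ι → ℕ) (B : ι → Finset (Fin n)) (hB : ∀ q, #(B q) = κ q) :
    phi (dB μ B) ≤ Phi μ κ := by
  rw [Phi_eq μ κ B hB, phi]
  refine Finset.sum_le_sum fun j _ => ?_
  rw [evec_dB]
  exact norm_sum_le _ _

lemma phi_eq_iff (μ : ι → PrimM m) (κ : ι → ℕ) (B : ι → Finset (Fin n))
    (hB : ∀ q, #(B q) = κ q) : phi (dB μ B) = Phi μ κ ↔ Nice1 μ B := by
  rw [Phi_eq μ κ B hB, phi, Finset.sum_eq_sum_iff_of_le]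
  swap
  · intro j _
    rw [evec_dB]
    exact norm_sum_le _ _
  constructor
  · intro h q q' j hq hq'
    have := h j (mem_univ j)
    rw [evec_dB] at this
    exact evec_sameRay _ _ (norm_sum_eq_sameRay _ _ this q q' (by simpa using hq) (by simpa using hq'))
  · intro h j _
    rw [evec_dB]
    by_cases hne : ∃ q0, j ∈ B q0
    · obtain ⟨q0, h0⟩ := hne
      have : ∀ q ∈ ({q | j ∈ B q} : Finset ι), μ q = μ q0 := fun q hq =>
        h q q0 j (by simpa using hq) h0
      rw [Finset.sum_congr rfl fun q hq => by rw [this q hq],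
        Finset.sum_congr (g := fun _ => ‖evec (μ q0).1‖) rfl fun q hq => by rw [this q hq]]
      simp [norm_smul, ← Nat.cast_smul_eq_nsmul ℝ]
    · push Not at hne
      simp [hne]

lemma psi_eq (μ : ι → PrimM m) (B : ι → Finset (Fin n)) (h1 : Nice1 μ B) :
    psi (dB μ B) =
      ∑ q, ∑ q', if μ q = μ q' then #(B q ∩ B q') * ∑ i, (μ q).1 i ^ 2 else 0 := by
  have : ∀ j i, dB μ B (i, j) ^ 2 =
      ∑ q, ∑ q', if j ∈ B q ∩ B q' then (if μ q = μ q' then (μ q).1 i ^ 2 else 0) else 0 := by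
    intro j i
    rw [dB_apply, sq, Finset.sum_mul_sum, Finset.sum_filter]
    refine Finset.sum_congr rfl fun q _ => ?_
    rw [Finset.sum_filter]
    split_ifs with hq
    · refine Finset.sum_congr rfl fun q' _ => ?_
      by_cases hq' : j ∈ B q'
      · have := h1 q q' j hq hq'
        simp [hq, hq', this, sq]
      · simp [hq']
    · simp [hq]
  simp only [psi, this]
  have e : ∀ j : Fin n, (∑ i : Fin m, ∑ q, ∑ q', if j ∈ B q ∩ B q' then
      (if μ q = μ q' then (μ q).1 i ^ 2 else 0) else 0) =
      ∑ q, ∑ q', if j ∈ B q ∩ B q' then (if μ q = μ q' then ∑ i, (μ q).1 i ^ 2 else 0) else 0 := by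
    intro j
    rw [Finset.sum_comm]
    refine Finset.sum_congr rfl fun q _ => ?_
    rw [Finset.sum_comm]
    refine Finset.sum_congr rfl fun q' _ => ?_
    split_ifs <;> simp
  simp only [e]
  rw [Finset.sum_comm]
  refine Finset.sum_congr rfl fun q _ => ?_
  rw [Finset.sum_comm]
  refine Finset.sum_congr rfl fun q' _ => ?_
  rw [← Finset.sum_filter, Finset.sum_const]
  split_ifs <;> simp [-mem_inter]

lemma sq_pos' (μ : PrimM m) : 0 < ∑ i, μ.1 i ^ 2 := by
  obtain ⟨i, hi⟩ := prim_ne μ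
  exact Finset.sum_pos' (fun _ _ => Nat.zero_le _) ⟨i, mem_univ i, by positivity⟩

lemma psi_le (μ : ι → PrimM m) (κ : ι → ℕ) (B : ι → Finset (Fin n)) (hB : ∀ q, #(B q) = κ q)
    (h1 : Nice1 μ B) : psi (dB μ B) ≤ Psi μ κ ∧ (psi (dB μ B) = Psi μ κ ↔ Nice2 μ B) := by
  have hle : ∀ q q', (if μ q = μ q' then #(B q ∩ B q') * ∑ i, (μ q).1 i ^ 2 else 0) ≤
      if μ q = μ q' then min (κ q) (κ q') * ∑ i, (μ q).1 i ^ 2 else 0 := by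
    intro q q'
    split_ifs
    · apply Nat.mul_le_mul_right
      rw [← hB, ← hB]
      exact le_min (card_le_card inter_subset_left) (card_le_card inter_subset_right)
    · exact le_rfl
  rw [psi_eq μ B h1, Psi]
  refine ⟨Finset.sum_le_sum fun q _ => Finset.sum_le_sum fun q' _ => hle q q', ?_⟩
  rw [Finset.sum_eq_sum_iff_of_le fun q _ => Finset.sum_le_sum fun q' _ => hle q q']
  have : ∀ q, ((∑ q', if μ q = μ q' then #(B q ∩ B q') * ∑ i, (μ q).1 i ^ 2 else 0) =
      (∑ q', if μ q = μ q' then min (κ q) (κ q') * ∑ i, (μ q).1 i ^ 2 else 0) ↔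
      ∀ q', μ q = μ q' → B q ⊆ B q' ∨ B q' ⊆ B q) := by
    intro q
    rw [Finset.sum_eq_sum_iff_of_le fun q' _ => hle q q']
    simp only [mem_univ, true_imp_iff]
    refine forall_congr' fun q' => ?_
    by_cases h : μ q = μ q'
    · simp only [h, if_true, true_imp_iff]
      rw [Nat.mul_left_inj (sq_pos' (μ q')).ne', ← hB, ← hB]
      constructor
      · intro hc
        rcases le_total (#(B q)) (#(B q')) with hl | hl
        · left
          rw [min_eq_left hl] at hc
          exact inter_eq_left.1 (eq_of_subset_of_card_le inter_subset_left hc.ge)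
        · right
          rw [min_eq_right hl] at hc
          exact inter_eq_right.1 (eq_of_subset_of_card_le inter_subset_right hc.ge)
      · rintro (hc | hc)
        · rw [inter_eq_left.2 hc, min_eq_left (card_le_card hc)]
        · rw [inter_eq_right.2 hc, min_eq_right (card_le_card hc)]
    · simp [h]
  simp only [mem_univ, true_imp_iff, this, Nice2]

def keyd (d : Fin m × Fin n →₀ ℕ) : ℝ ×ₗ ℕ := toLex (phi d, psi d)
def keyk (μ : ι → PrimM m) (κ : ι → ℕ) : ℝ ×ₗ ℕ := toLex (Phi μ κ, Psi μ κ)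

lemma key_le (μ : ι → PrimM m) (κ : ι → ℕ) (B : ι → Finset (Fin n)) (hB : ∀ q, #(B q) = κ q) :
    keyd (dB μ B) ≤ keyk μ κ := by
  rw [keyd, keyk, Prod.Lex.toLex_le_toLex]
  rcases (phi_le μ κ B hB).lt_or_eq with h | h
  · exact Or.inl h
  · exact Or.inr ⟨h, (psi_le μ κ B hB ((phi_eq_iff μ κ B hB).1 h)).1⟩

lemma key_eq_iff (μ : ι → PrimM m) (κ : ι → ℕ) (B : ι → Finset (Fin n))
    (hB : ∀ q, #(B q) = κ q) : keyd (dB μ B) = keyk μ κ ↔ Nice1 μ B ∧ Nice2 μ B := by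
  rw [keyd, keyk, toLex_inj, Prod.mk.injEq]
  rw [phi_eq_iff μ κ B hB]
  constructor
  · rintro ⟨h1, h2⟩
    exact ⟨h1, (psi_le μ κ B hB h1).2.1 h2⟩
  · rintro ⟨h1, h2⟩
    exact ⟨h1, (psi_le μ κ B hB h1).2.2 h2⟩

end config

section types

variable {m n : ℕ}

def HH (d : Fin m × Fin n →₀ ℕ) (μ : PrimM m) (t : ℕ) : Finset (Fin n) :=
  {j | ∃ b, t < b ∧ ∀ i, d (i, j) = b * μ.1 i}

def tau (d : Fin m × Fin n →₀ ℕ) (μ : PrimM m) (t : ℕ) : ℕ := #(HH d μ t)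

lemma mem_HH {d : Fin m × Fin n →₀ ℕ} {μ : PrimM m} {t : ℕ} {j : Fin n} :
    j ∈ HH d μ t ↔ ∃ b, t < b ∧ ∀ i, d (i, j) = b * μ.1 i := by
  simp [HH]

lemma HH_anti (d : Fin m × Fin n →₀ ℕ) (μ : PrimM m) {t t' : ℕ} (h : t ≤ t') :
    HH d μ t' ⊆ HH d μ t := by
  intro j hj
  obtain ⟨b, hb, h'⟩ := mem_HH.1 hj
  exact mem_HH.2 ⟨b, by omega, h'⟩

lemma tau_anti (d : Fin m × Fin n →₀ ℕ) (μ : PrimM m) : Antitone (tau d μ) :=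
  fun _ _ h => card_le_card (HH_anti d μ h)

abbrev Idx (S : Finset (PrimM m)) (T : ℕ) := S × Fin T

def muI (S : Finset (PrimM m)) (T : ℕ) : Idx S T → PrimM m := fun q => q.1.1
def kI (S : Finset (PrimM m)) (T : ℕ) (k : PrimM m → ℕ → ℕ) : Idx S T → ℕ := fun q => k q.1.1 q.2

lemma dB_col_of_nice {ι : Type} [Fintype ι] (μ : ι → PrimM m) (B : ι → Finset (Fin n))
    (h1 : Nice1 μ B) (q0 : ι) (j : Fin n) (hj : j ∈ B q0) (i : Fin m) :
    dB μ B (i, j) = #{q | j ∈ B q} * (μ q0).1 i := by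
  rw [dB_apply, Finset.sum_congr (g := fun _ => (μ q0).1 i) rfl]
  · simp
  · intro q hq
    rw [h1 q q0 j (by simpa using hq) hj]

lemma nice_eq_HH (S : Finset (PrimM m)) (T : ℕ) (k : PrimM m → ℕ → ℕ) (hk : ∀ μ, Antitone (k μ))
    (B : Idx S T → Finset (Fin n)) (hB : ∀ q, #(B q) = kI S T k q)
    (h1 : Nice1 (muI S T) B) (h2 : Nice2 (muI S T) B) (q : Idx S T) :
    B q = HH (dB (muI S T) B) q.1.1 q.2 := by
  have hsub : ∀ (μ : S) (t t' : Fin T), t ≤ t' → B (μ, t') ⊆ B (μ, t) := by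
    intro μ t t' htt
    rcases h2 (μ, t) (μ, t') rfl with h | h
    · refine (eq_of_subset_of_card_le h ?_).ge
      rw [hB, hB]
      exact hk μ.1 htt
    · exact h
  obtain ⟨μ, t⟩ := q
  ext j
  rw [mem_HH]
  constructor
  · intro hj
    refine ⟨_, ?_, fun i => dB_col_of_nice _ B h1 (μ, t) j hj i⟩
    have : (Finset.Iic t).image (fun t' => ((μ, t') : Idx S T)) ⊆ ({q | j ∈ B q} : Finset (Idx S T)) := by
      intro q hq
      obtain ⟨t', ht', rfl⟩ := Finset.mem_image.1 hq
      simp only [mem_filter, mem_univ, true_and]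
      exact hsub μ t' t (Finset.mem_Iic.1 ht') hj
    have := card_le_card this
    rw [Finset.card_image_of_injective _ (fun a b h => (Prod.ext_iff.1 h).2)] at this
    simp only [Fin.card_Iic] at this
    exact this
  · rintro ⟨b, hb, hd⟩
    have hne : ∃ q0, j ∈ B q0 := by
      by_contra hno
      push Not at hno
      obtain ⟨i, hi⟩ := prim_ne μ.1
      have := hd i
      rw [dB_apply] at this
      simp [hno] at this
      rcases this with h | h
      · omega
      · exact hi h
    obtain ⟨q0, hq0⟩ := hne
    have hcol := dB_col_of_nice _ B h1 q0 j hq0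
    have hun := prim_unique μ.1 (muI S T q0) b _ (by omega) fun i => (hd i).symm.trans (hcol i)
    by_contra hj
    have : ({q | j ∈ B q} : Finset (Idx S T)) ⊆
        (Finset.Iio t).image (fun t' => ((μ, t') : Idx S T)) := by
      rintro ⟨μ', t'⟩ hq
      simp only [mem_filter, mem_univ, true_and] at hq
      have hμ : μ' = μ := by
        have := h1 _ _ j hq hq0
        rw [← hun.1] at this
        exact Subtype.ext this
      subst hμ
      refine Finset.mem_image.2 ⟨t', Finset.mem_Iio.2 ?_, rfl⟩
      by_contra hlt
      exact hj (hsub μ' t t' (not_lt.1 hlt) hq)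
    have := card_le_card this
    rw [Finset.card_image_of_injective _ (fun a b h => (Prod.ext_iff.1 h).2)] at this
    simp only [Fin.card_Iio] at this
    simp only at hb
    omega

/-- total degree -/
def tdeg (d : Fin m × Fin n →₀ ℕ) : ℕ := ∑ j, ∑ i, d (i, j)

def Cov (S : Finset (PrimM m)) (T : ℕ) (d : Fin m × Fin n →₀ ℕ) : Prop :=
  ∀ μ t, (HH d μ t).Nonempty → μ ∈ S ∧ t < T

lemma HH_nice1 (S : Finset (PrimM m)) (T : ℕ) (d : Fin m × Fin n →₀ ℕ) :
    Nice1 (muI S T) (fun q => HH d q.1.1 q.2) := by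
  intro q q' j h h'
  obtain ⟨b, hb, hd⟩ := mem_HH.1 h
  obtain ⟨b', hb', hd'⟩ := mem_HH.1 h'
  exact (prim_unique _ _ b b' (by omega) fun i => (hd i).symm.trans (hd' i)).1

lemma HH_nice2 (S : Finset (PrimM m)) (T : ℕ) (d : Fin m × Fin n →₀ ℕ) :
    Nice2 (muI S T) (fun q => HH d q.1.1 q.2) := by
  rintro ⟨μ, t⟩ ⟨μ', t'⟩ h
  have h : μ = μ' := Subtype.ext h
  subst h
  rcases le_total t t' with h | h
  · exact Or.inr (HH_anti d _ h)
  · exact Or.inl (HH_anti d _ h)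

lemma dB_HH (S : Finset (PrimM m)) (T : ℕ) (d : Fin m × Fin n →₀ ℕ) (hc : Cov S T d) :
    dB (muI S T) (fun q => HH d q.1.1 q.2) = d := by
  ext ⟨i, j⟩
  by_cases h0 : (fun i => d (i, j)) = 0
  · have hd : ∀ i, d (i, j) = 0 := fun i => congrFun h0 i
    rw [hd, dB_apply, Finset.sum_eq_zero]
    intro q hq
    simp only [mem_filter, mem_univ, true_and] at hq
    obtain ⟨b, hb, h⟩ := mem_HH.1 hq
    have := h i
    rw [hd] at this
    rcases Nat.mul_eq_zero.1 this.symm with h | h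
    · omega
    · exact h
  · obtain ⟨μ, t, hd⟩ := prim_exists _ h0
    have hj : j ∈ HH d μ t := mem_HH.2 ⟨t + 1, by omega, hd⟩
    obtain ⟨hS, hT⟩ := hc μ t ⟨j, hj⟩
    rw [dB_col_of_nice (muI S T) _ (HH_nice1 S T d) (⟨μ, hS⟩, ⟨t, hT⟩) j hj, hd i]
    congr 1
    have : ({q | j ∈ HH d q.1.1 q.2} : Finset (Idx S T)) =
        (Finset.Iic (⟨t, hT⟩ : Fin T)).image (fun t' => ((⟨μ, hS⟩, t') : Idx S T)) := by
      ext ⟨μ', t'⟩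
      simp only [mem_filter, mem_univ, true_and, Finset.mem_image, Finset.mem_Iic, Prod.mk.injEq]
      constructor
      · intro h
        obtain ⟨b, hb, hd'⟩ := mem_HH.1 h
        have := prim_unique μ μ'.1 (t + 1) b (by omega) fun i => (hd i).symm.trans (hd' i)
        refine ⟨t', ?_, Subtype.ext this.1, rfl⟩
        rw [Fin.le_def]
        simp only
        omega
      · rintro ⟨t'', h, h', h''⟩
        subst h' h''
        exact HH_anti d μ (Fin.le_def.1 h) hj
    rw [this, Finset.card_image_of_injective _ (fun a b h => (Prod.ext_iff.1 h).2)]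
    simp

lemma keyd_eq (S : Finset (PrimM m)) (T : ℕ) (d : Fin m × Fin n →₀ ℕ) (hc : Cov S T d) :
    keyd d = keyk (muI S T) (kI S T (tau d)) := by
  have := (key_eq_iff (muI S T) (kI S T (tau d)) (fun q => HH d q.1.1 q.2) fun q => rfl).2
    ⟨HH_nice1 S T d, HH_nice2 S T d⟩
  rwa [dB_HH S T d hc] at this

lemma conf_unique (S : Finset (PrimM m)) (T : ℕ) (k : PrimM m → ℕ → ℕ) (hk : ∀ μ, Antitone (k μ))
    (B : Idx S T → Finset (Fin n)) (hB : ∀ q, #(B q) = kI S T k q)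
    (h : keyd (dB (muI S T) B) = keyk (muI S T) (kI S T k)) (q : Idx S T) :
    B q = HH (dB (muI S T) B) q.1.1 q.2 := by
  have := (key_eq_iff _ _ B hB).1 h
  exact nice_eq_HH S T k hk B hB this.1 this.2 q

lemma exists_perm_of_card {β : Type*} [DecidableEq β] (f g : Fin n → β)
    (h : ∀ b, #{j | f j = b} = #{j | g j = b}) : ∃ σ : Equiv.Perm (Fin n), ∀ j, g (σ j) = f j := by
  have e : ∀ b, Nonempty ({j // f j = b} ≃ {j // g j = b}) := by
    intro b
    refine ⟨Fintype.equivOfCardEq ?_⟩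
    rw [Fintype.card_subtype, Fintype.card_subtype]
    exact h b
  let σ : Equiv.Perm (Fin n) := (Equiv.sigmaFiberEquiv f).symm.trans
    ((Equiv.sigmaCongrRight fun b => (e b).some).trans (Equiv.sigmaFiberEquiv g))
  refine ⟨σ, fun j => ?_⟩
  exact ((e (f j)).some ⟨j, rfl⟩).2

lemma tau_orbit (d d' : Fin m × Fin n →₀ ℕ) (h : tau d = tau d') :
    ∃ σ : Equiv.Perm (Fin n), ∀ i j, d' (i, σ j) = d (i, j) := by
  have key : ∀ b : Fin m → ℕ, b ≠ 0 →
      #{j | (fun i => d (i, j)) = b} = #{j | (fun i => d' (i, j)) = b} := by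
    intro b hb
    obtain ⟨μ, t, hμ⟩ := prim_exists b hb
    have aux : ∀ d : Fin m × Fin n →₀ ℕ, #{j | (fun i => d (i, j)) = b} = tau d μ t - tau d μ (t+1) := by
      intro d
      rw [tau, tau, ← Finset.card_sdiff_of_subset (HH_anti d μ (Nat.le_succ t))]
      congr 1
      ext j
      simp only [mem_filter, mem_univ, true_and, mem_sdiff, mem_HH]
      constructor
      · intro hj
        have hj' : ∀ i, d (i, j) = (t + 1) * μ.1 i := fun i => (congrFun hj i).trans (hμ i)
        refine ⟨⟨t + 1, by omega, hj'⟩, ?_⟩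
        rintro ⟨c, hc, h'⟩
        have := (prim_unique μ μ (t+1) c (by omega) fun i => (hj' i).symm.trans (h' i)).2
        omega
      · rintro ⟨⟨c, hc, h'⟩, hn⟩
        have : c = t + 1 := by
          by_contra hne
          exact hn ⟨c, by omega, h'⟩
        subst this
        funext i
        rw [h' i, hμ i]
    rw [aux, aux, h]
  obtain ⟨σ, hσ⟩ := exists_perm_of_card (fun j i => d (i, j)) (fun j i => d' (i, j)) (by
    intro b
    by_cases hb : b = 0
    · subst hb
      set U : Finset (Fin m → ℕ) := insert 0 ((univ.image fun j i => d (i, j)) ∪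
        (univ.image fun j i => d' (i, j))) with hU
      have h0 : (0 : Fin m → ℕ) ∈ U := mem_insert_self _ _
      have e1 := Finset.card_eq_sum_card_fiberwise (s := (univ : Finset (Fin n))) (t := U)
        (f := fun j i => d (i, j)) (fun j _ => by
          simp only [hU, coe_insert, coe_union, coe_image]
          right; left; exact ⟨j, by simp, rfl⟩)
      have e2 := Finset.card_eq_sum_card_fiberwise (s := (univ : Finset (Fin n))) (t := U)
        (f := fun j i => d' (i, j)) (fun j _ => by
          simp only [hU, coe_insert, coe_union, coe_image]
          right; right; exact ⟨j, by simp, rfl⟩)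
      rw [← Finset.add_sum_erase U _ h0] at e1 e2
      have e3 := Finset.sum_congr (s₁ := U.erase 0) rfl fun b hb => key b (Finset.mem_erase.1 hb).1
      omega
    · exact key b hb)
  exact ⟨σ, fun i j => congrFun (hσ j) i⟩

end types

section expand

variable {m : ℕ}

abbrev GenM (m : ℕ) := {p : ℕ × (Fin m →₀ ℕ) // 1 ≤ p.1 ∧ Primitive m p.2}

def ev (m n : ℕ) : MvPolynomial (GenM m) ℤ →ₐ[ℤ] MvPolynomial (Fin m × Fin n) ℤ :=
  aeval (fun g => esymVal n (fun j => subst m n (monomial g.1.2 (1 : ℤ)) j) g.1.1)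

lemma sigmaMap_apply (p : MvPolynomial (GenM m) ℤ) (n : ℕ) : sigmaMap m p n = ev m n p := by
  have : (Pi.evalAlgHom ℤ (fun n : ℕ => MvPolynomial (Fin m × Fin n) ℤ) n).comp (sigmaMap m) = ev m n := by
    apply MvPolynomial.algHom_ext
    intro g
    simp [sigmaMap, ev]
  rw [← this]
  rfl

def Xg (i : ℕ) (μ : PrimM m) : MvPolynomial (GenM m) ℤ :=
  if h : 1 ≤ i then X ⟨(i, μ.1), h, μ.2⟩ else 1

lemma esymVal_mono (n k : ℕ) (μ : Fin m →₀ ℕ) :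
    esymVal n (fun j => subst m n (monomial μ (1 : ℤ)) j) k =
      ∑ A ∈ powersetCard k (univ : Finset (Fin n)),
        monomial (∑ j ∈ A, Finsupp.mapDomain (fun i => (i, j)) μ) (1 : ℤ) := by
  rw [esymVal]
  refine Finset.sum_congr rfl fun A _ => ?_
  simp only [subst, rename_monomial]
  rw [MvPolynomial.monomial_sum_one]

lemma ev_Xg (n i : ℕ) (μ : PrimM m) :
    ev m n (Xg i μ) = ∑ A ∈ powersetCard i (univ : Finset (Fin n)),
        monomial (∑ j ∈ A, Finsupp.mapDomain (fun i => (i, j)) μ.1) (1 : ℤ) := by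
  rw [Xg]
  split_ifs with h
  · rw [ev, aeval_X, esymVal_mono]
  · have : i = 0 := by omega
    subst this
    simp

def Mk (S : Finset (PrimM m)) (T : ℕ) (k : PrimM m → ℕ → ℕ) : MvPolynomial (GenM m) ℤ :=
  ∏ q : Idx S T, Xg (kI S T k q) (muI S T q)

lemma ev_Mk (n : ℕ) (S : Finset (PrimM m)) (T : ℕ) (k : PrimM m → ℕ → ℕ) :
    ev m n (Mk S T k) =
      ∑ B ∈ Fintype.piFinset (fun q : Idx S T => powersetCard (kI S T k q) (univ : Finset (Fin n))),
        monomial (dB (muI S T) B) (1 : ℤ) := by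
  rw [Mk, map_prod]
  simp only [ev_Xg]
  rw [Finset.prod_univ_sum]
  refine Finset.sum_congr rfl fun B _ => ?_
  rw [dB, MvPolynomial.monomial_sum_one]

lemma coeff_ev_Mk_ne {n : ℕ} {S : Finset (PrimM m)} {T : ℕ} {k : PrimM m → ℕ → ℕ}
    {d : Fin m × Fin n →₀ ℕ} (h : coeff d (ev m n (Mk S T k)) ≠ 0) :
    ∃ B : Idx S T → Finset (Fin n), (∀ q, #(B q) = kI S T k q) ∧ dB (muI S T) B = d := by
  rw [ev_Mk, coeff_sum] at h
  obtain ⟨B, hB, hne⟩ := Finset.exists_ne_zero_of_sum_ne_zero h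
  refine ⟨B, fun q => ?_, ?_⟩
  · exact (mem_powersetCard.1 (Fintype.mem_piFinset.1 hB q)).2
  · rw [coeff_monomial] at hne
    by_contra hd
    simp [hd] at hne

lemma kI_eq_of_key {n : ℕ} {S : Finset (PrimM m)} {T : ℕ} {k : PrimM m → ℕ → ℕ}
    (hk : ∀ μ, Antitone (k μ)) (B : Idx S T → Finset (Fin n)) (hB : ∀ q, #(B q) = kI S T k q)
    (h : keyd (dB (muI S T) B) = keyk (muI S T) (kI S T k)) :
    kI S T k = kI S T (tau (dB (muI S T) B)) := by
  funext q
  rw [← hB, conf_unique S T k hk B hB h q]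
  rfl

lemma coeff_ev_Mk_one {n : ℕ} {S : Finset (PrimM m)} {T : ℕ} {k : PrimM m → ℕ → ℕ}
    (hk : ∀ μ, Antitone (k μ)) {d : Fin m × Fin n →₀ ℕ} (hc : Cov S T d)
    (h : kI S T k = kI S T (tau d)) : coeff d (ev m n (Mk S T k)) = 1 := by
  rw [ev_Mk, coeff_sum, Finset.sum_eq_single (fun q => HH d q.1.1 q.2)]
  · rw [dB_HH S T d hc, coeff_monomial, if_pos rfl]
  · intro B hB hne
    rw [coeff_monomial, if_neg]
    intro hd
    apply hne
    funext q
    have hB' : ∀ q, #(B q) = kI S T k q := fun q =>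
      (mem_powersetCard.1 (Fintype.mem_piFinset.1 hB q)).2
    rw [conf_unique S T k hk B hB' (by rw [hd, keyd_eq S T d hc, h]) q, hd]
  · intro hn
    exfalso
    apply hn
    rw [Fintype.mem_piFinset]
    intro q
    rw [mem_powersetCard, h]
    exact ⟨subset_univ _, rfl⟩

lemma tdeg_dB {n : ℕ} {ι : Type} [Fintype ι] (μ : ι → PrimM m) (κ : ι → ℕ) (B : ι → Finset (Fin n))
    (hB : ∀ q, #(B q) = κ q) : tdeg (dB μ B) = ∑ q, κ q * ∑ i, (μ q).1 i := by
  simp only [tdeg, dB_apply, Finset.sum_filter]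
  have : ∀ j, (∑ i, ∑ q, if j ∈ B q then (μ q).1 i else 0) =
      ∑ q, if j ∈ B q then ∑ i, (μ q).1 i else 0 := by
    intro j
    rw [Finset.sum_comm]
    refine Finset.sum_congr rfl fun q _ => ?_
    split_ifs <;> simp
  simp only [this]
  rw [Finset.sum_comm]
  refine Finset.sum_congr rfl fun q _ => ?_
  rw [← Finset.sum_filter, Finset.sum_const, ← hB]
  simp

lemma SN_fin (m N : ℕ) : {μ : PrimM m | ∑ i, μ.1 i ≤ N}.Finite := by
  have : (Set.Iic (Finsupp.equivFunOnFinite.symm fun _ : Fin m => N)).Finite := Set.finite_Iic _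
  refine (this.preimage (f := fun μ : PrimM m => μ.1) Subtype.val_injective.injOn).subset ?_
  intro μ hμ
  simp only [Set.mem_preimage, Set.mem_Iic]
  intro i
  simp only [Finsupp.equivFunOnFinite_symm_apply_apply]
  exact (Finset.single_le_sum (f := fun i => μ.1 i) (fun _ _ => Nat.zero_le _) (mem_univ i)).trans hμ

def SN (m N : ℕ) : Finset (PrimM m) := (SN_fin m N).toFinset

lemma cov_SN {n N : ℕ} (d : Fin m × Fin n →₀ ℕ) (hd : tdeg d ≤ N) : Cov (SN m N) N d := by
  rintro μ t ⟨j, hj⟩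
  obtain ⟨b, hb, h⟩ := mem_HH.1 hj
  have h1 : b * ∑ i, μ.1 i ≤ N := by
    refine le_trans ?_ hd
    rw [Finset.mul_sum, tdeg]
    simp only [← h]
    exact Finset.single_le_sum (f := fun j => ∑ i, d (i, j)) (fun _ _ => Nat.zero_le _) (mem_univ j)
  have h2 : 0 < ∑ i, μ.1 i := by
    obtain ⟨i, hi⟩ := prim_ne μ
    exact Finset.sum_pos' (fun _ _ => Nat.zero_le _) ⟨i, mem_univ i, by positivity⟩
  constructor
  · simp only [SN, Set.Finite.mem_toFinset, Set.mem_ofPred_eq]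
    nlinarith
  · nlinarith

lemma tdeg_fin (m n N : ℕ) : {d : Fin m × Fin n →₀ ℕ | tdeg d ≤ N}.Finite := by
  have : (Set.Iic (Finsupp.equivFunOnFinite.symm fun _ : Fin m × Fin n => N)).Finite :=
    Set.finite_Iic _
  refine this.subset ?_
  intro d hd
  rintro ⟨i, j⟩
  simp only [Finsupp.equivFunOnFinite_symm_apply_apply]
  refine le_trans ?_ hd
  exact (Finset.single_le_sum (f := fun i => d (i, j)) (fun _ _ => Nat.zero_le _) (mem_univ i)).trans
    (Finset.single_le_sum (f := fun j => ∑ i, d (i, j)) (fun _ _ => Nat.zero_le _) (mem_univ j))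

lemma tau_eq_of_kI {n : ℕ} {S : Finset (PrimM m)} {T : ℕ} (d d' : Fin m × Fin n →₀ ℕ)
    (h : Cov S T d) (h' : Cov S T d') (hk : kI S T (tau d) = kI S T (tau d')) : tau d = tau d' := by
  funext μ t
  by_cases hST : μ ∈ S ∧ t < T
  · exact congrFun hk (⟨μ, hST.1⟩, ⟨t, hST.2⟩)
  · have e1 : HH d μ t = ∅ := by
      by_contra hne
      exact hST (h μ t (Finset.nonempty_iff_ne_empty.2 hne))
    have e2 : HH d' μ t = ∅ := by
      by_contra hne
      exact hST (h' μ t (Finset.nonempty_iff_ne_empty.2 hne))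
    rw [tau, tau, e1, e2]

lemma coeff_perm {n : ℕ} (f : MvPolynomial (Fin m × Fin n) ℤ) (hf : f ∈ invAlg ℤ m n)
    (d d' : Fin m × Fin n →₀ ℕ) (σ : Equiv.Perm (Fin n)) (h : ∀ i j, d' (i, σ j) = d (i, j)) :
    coeff d f = coeff d' f := by
  have hinj : Function.Injective (fun q : Fin m × Fin n => (q.1, σ q.2)) := by
    rintro ⟨a, b⟩ ⟨a', b'⟩ hab
    simpa using hab
  have h1 : d' = Finsupp.mapDomain (fun q : Fin m × Fin n => (q.1, σ q.2)) d := by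
    ext ⟨i, j⟩
    have := Finsupp.mapDomain_apply hinj d (i, σ.symm j)
    simp only [Equiv.apply_symm_apply] at this
    rw [this, ← h, Equiv.apply_symm_apply]
  have h2 := hf σ
  rw [permRename] at h2
  rw [h1]
  conv_rhs => rw [← h2]
  exact (coeff_rename_mapDomain _ hinj _ _).symm

lemma ev_perm (n : ℕ) (p : MvPolynomial (GenM m) ℤ) : ev m n p ∈ invAlg ℤ m n := by
  intro σ
  have : (permRename m n σ).comp (ev m n) = ev m n := by
    apply MvPolynomial.algHom_ext
    intro g
    simp only [AlgHom.comp_apply, ev, aeval_X, esymVal, map_sum, map_prod]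
    refine Finset.sum_bij' (fun A _ => A.map σ.toEmbedding) (fun A _ => A.map σ.symm.toEmbedding)
      ?_ ?_ ?_ ?_ ?_
    · intro A hA; simpa using hA
    · intro A hA; simpa using hA
    · intro A hA; ext; simp
    · intro A hA; ext; simp
    · intro A hA
      rw [Finset.prod_map]
      refine Finset.prod_congr rfl fun j _ => ?_
      simp [subst, permRename, rename_rename, Function.comp_def]
  exact DFunLike.congr_fun this p

/-- surjectivity at a finite level -/
lemma surj_level (n N : ℕ) (D : Finset (PrimM m → ℕ → ℕ))
    (hanti : ∀ a ∈ D, ∀ μ, Antitone (a μ))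
    (hdown : ∀ a ∈ D, ∀ d : Fin m × Fin n →₀ ℕ, tdeg d ≤ N →
      keyd d < keyk (muI (SN m N) N) (kI (SN m N) N a) → tau d ∈ D) :
    ∀ f ∈ invAlg ℤ m n, (∀ d ∈ f.support, tdeg d ≤ N ∧ tau d ∈ D) →
      ∃ p, ev m n p = f ∧ ∀ n', ∀ d ∈ (ev m n' p).support, tdeg d ≤ N := by
  induction D using Finset.induction_on_max_value
    (fun a => keyk (muI (SN m N) N) (kI (SN m N) N a)) with
  | empty =>
    intro f _ hs
    refine ⟨0, ?_, by simp⟩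
    rw [map_zero]
    symm
    rw [← MvPolynomial.support_eq_empty, Finset.eq_empty_iff_forall_notMem]
    intro d hd
    simpa using (hs d hd).2
  | insert a D haD hmax ih =>
    have ih' := ih (fun b hb => hanti b (mem_insert_of_mem hb)) (by
      intro b hb d hd hlt
      have := hdown b (mem_insert_of_mem hb) d hd hlt
      rcases mem_insert.1 this with h | h
      · exfalso
        rw [keyd_eq (SN m N) N d (cov_SN d hd), h] at hlt
        exact absurd (hmax b hb) (not_le.2 hlt)
      · exact h)
    intro f hf hs
    by_cases hex : ∃ d ∈ f.support, tau d = a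
    swap
    · apply ih' f hf
      intro d hd
      refine ⟨(hs d hd).1, (mem_insert.1 (hs d hd).2).resolve_left fun h => hex ⟨d, hd, h⟩⟩
    obtain ⟨d0, hd0, ha⟩ := hex
    have hN0 := (hs d0 hd0).1
    have hcov0 := cov_SN d0 hN0
    have haa := hanti a (mem_insert_self _ _)
    have hdeg : ∀ n', ∀ d ∈ (ev m n' (Mk (SN m N) N a)).support, tdeg d ≤ N := by
      intro n' d hd
      obtain ⟨B, hB, rfl⟩ := coeff_ev_Mk_ne (MvPolynomial.mem_support_iff.1 hd)
      rw [tdeg_dB _ _ B hB]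
      refine le_trans (le_of_eq ?_) hN0
      conv_rhs => rw [← dB_HH (SN m N) N d0 hcov0]
      rw [tdeg_dB (muI (SN m N) N) (kI (SN m N) N a)]
      intro q
      rw [← ha]; rfl
    obtain ⟨p, hp, hpd⟩ := ih' (f - ev m n (C (coeff d0 f) * Mk (SN m N) N a))
      (Subalgebra.sub_mem _ hf (ev_perm n _)) (by
        intro d hd
        have hC : ev m n (C (coeff d0 f) * Mk (SN m N) N a) =
            C (coeff d0 f) * ev m n (Mk (SN m N) N a) := by
          rw [map_mul]; congr 1; simp [ev]
        rw [MvPolynomial.mem_support_iff, coeff_sub, hC, coeff_C_mul] at hd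
        have hdN : tdeg d ≤ N := by
          by_cases h1 : coeff d f = 0
          · by_cases h2 : coeff d (ev m n (Mk (SN m N) N a)) = 0
            · simp [h1, h2] at hd
            · exact hdeg n d (MvPolynomial.mem_support_iff.2 h2)
          · exact (hs d (MvPolynomial.mem_support_iff.2 h1)).1
        refine ⟨hdN, ?_⟩
        have hcov := cov_SN d hdN
        have hta : tau d ≠ a := by
          intro h
          apply hd
          rw [coeff_ev_Mk_one haa hcov (by rw [h])]
          obtain ⟨σ, hσ⟩ := tau_orbit d d0 (h.trans ha.symm)
          rw [coeff_perm f hf d d0 σ hσ]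
          ring
        have : tau d ∈ insert a D := by
          by_cases h1 : coeff d f = 0
          · by_cases h2 : coeff d (ev m n (Mk (SN m N) N a)) = 0
            · simp [h1, h2] at hd
            · obtain ⟨B, hB, rfl⟩ := coeff_ev_Mk_ne h2
              rcases (key_le _ _ B hB).lt_or_eq with h | h
              · exact hdown a (mem_insert_self _ _) _ hdN h
              · exfalso
                apply hta
                rw [← ha]
                refine tau_eq_of_kI _ _ hcov hcov0 ?_
                rw [ha]
                exact (kI_eq_of_key haa B hB h).symm
          · exact (hs d (MvPolynomial.mem_support_iff.2 h1)).2
        exact (mem_insert.1 this).resolve_left hta)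
    refine ⟨p + C (coeff d0 f) * Mk (SN m N) N a, by rw [map_add, hp]; ring, ?_⟩
    intro n' d hd
    have hC : ev m n' (C (coeff d0 f) * Mk (SN m N) N a) =
        C (coeff d0 f) * ev m n' (Mk (SN m N) N a) := by
      rw [map_mul]; congr 1; simp [ev]
    rw [MvPolynomial.mem_support_iff, map_add, coeff_add, hC, coeff_C_mul] at hd
    by_cases h1 : coeff d (ev m n' p) = 0
    · by_cases h2 : coeff d (ev m n' (Mk (SN m N) N a)) = 0
      · simp [h1, h2] at hd
      · exact hdeg n' d (MvPolynomial.mem_support_iff.2 h2)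
    · exact hpd n' d (MvPolynomial.mem_support_iff.2 h1)

lemma surj_level' (n N : ℕ) (f : MvPolynomial (Fin m × Fin n) ℤ) (hf : f ∈ invAlg ℤ m n)
    (hd : ∀ d ∈ f.support, tdeg d ≤ N) :
    ∃ p, ev m n p = f ∧ ∀ n', ∀ d ∈ (ev m n' p).support, tdeg d ≤ N := by
  refine surj_level n N ((tdeg_fin m n N).toFinset.image tau) ?_ ?_ f hf ?_
  · intro a ha μ
    obtain ⟨d, _, rfl⟩ := Finset.mem_image.1 ha
    exact tau_anti d μ
  · intro a _ d hdN _
    exact mem_image_of_mem _ (by simpa using hdN)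
  · intro d h
    exact ⟨hd d h, mem_image_of_mem _ (by simpa using hd d h)⟩

end expand

section final

variable {m : ℕ}

lemma castS_inj (m n : ℕ) :
    Function.Injective (fun q : Fin m × Fin n => ((q.1, q.2.castSucc) : Fin m × Fin (n + 1))) := by
  rintro ⟨a, b⟩ ⟨a', b'⟩ hab
  simpa using hab

lemma projDown_eq (m n : ℕ) : projDown ℤ m n = killCompl (castS_inj m n) := by
  apply MvPolynomial.algHom_ext
  rintro ⟨i, j⟩
  by_cases hj : (j : ℕ) < n
  · have e : ((i, j) : Fin m × Fin (n + 1)) = (fun q : Fin m × Fin n => (q.1, q.2.castSucc)) (i, ⟨j, hj⟩) := rfl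
    have h2 : killCompl (R := ℤ) (castS_inj m n) (X (i, j)) = X (i, ⟨j, hj⟩) := by
      rw [e, ← rename_X (R := ℤ) (fun q : Fin m × Fin n => ((q.1, q.2.castSucc) : Fin m × Fin (n + 1))),
        killCompl_rename_app]
    rw [h2]
    simp [projDown, hj]
  · have : (i, j) ∉ Set.range (fun q : Fin m × Fin n => ((q.1, q.2.castSucc) : Fin m × Fin (n + 1))) := by
      rintro ⟨⟨a, b⟩, h⟩
      simp only [Prod.mk.injEq] at h
      apply hj
      rw [← h.2]
      exact b.2
    simp only [projDown, killCompl, aeval_X, dif_neg hj, dif_neg this]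

lemma coeff_projDown {n : ℕ} (f : MvPolynomial (Fin m × Fin (n + 1)) ℤ) (d : Fin m × Fin n →₀ ℕ) :
    coeff d (projDown ℤ m n f) =
      coeff (d.mapDomain (fun q : Fin m × Fin n => ((q.1, q.2.castSucc) : Fin m × Fin (n + 1)))) f := by
  rw [projDown_eq, coeff_killCompl]

lemma ev_proj (n : ℕ) (p : MvPolynomial (GenM m) ℤ) : projDown ℤ m n (ev m (n + 1) p) = ev m n p := by
  have : (projDown ℤ m n).comp (ev m (n + 1)) = ev m n := by
    apply MvPolynomial.algHom_ext
    intro g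
    simp only [AlgHom.comp_apply, ev, aeval_X, esymVal, map_sum, map_prod]
    have hlast : projDown ℤ m n (subst m (n + 1) (monomial g.1.2 (1 : ℤ)) (Fin.last n)) = 0 := by
      obtain ⟨i, hi⟩ := prim_ne ⟨g.1.2, g.2.2⟩
      rw [subst, rename_monomial, projDown_eq]
      refine killCompl_monomial_eq_zero_of_notMem_range _ _ (a := (i, Fin.last n)) ?_ ?_
      · rw [Finsupp.mem_support_iff, mapDomain_col]
        simpa using hi
      · rintro ⟨⟨a, b⟩, h⟩
        simp only [Prod.mk.injEq] at h
        exact (Fin.castSucc_lt_last b).ne h.2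
    have hcast : ∀ j : Fin n, projDown ℤ m n (subst m (n + 1) (monomial g.1.2 (1 : ℤ)) j.castSucc) =
        subst m n (monomial g.1.2 (1 : ℤ)) j := by
      intro j
      have : subst m (n + 1) (monomial g.1.2 (1 : ℤ)) j.castSucc =
        rename (fun q : Fin m × Fin n => ((q.1, q.2.castSucc) : Fin m × Fin (n + 1)))
          (subst m n (monomial g.1.2 (1 : ℤ)) j) := by
        simp [subst, rename_rename, Function.comp_def]
      rw [this, projDown_eq, killCompl_rename_app]
    rw [← Finset.sum_subset (powersetCard_mono (subset_univ
      ((univ : Finset (Fin n)).map Fin.castSuccEmb)))]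
    · rw [powersetCard_map, Finset.sum_map]
      refine Finset.sum_congr rfl fun A _ => ?_
      simp only [mapEmbedding_apply, RelEmbedding.coe_toEmbedding, Finset.prod_map]
      exact Finset.prod_congr rfl fun j _ => hcast j
    · intro A hA hA'
      refine Finset.prod_eq_zero (i := Fin.last n) ?_ hlast
      by_contra hl
      apply hA'
      rw [mem_powersetCard]
      refine ⟨fun j hj => ?_, (mem_powersetCard.1 hA).2⟩
      have hne : j ≠ Fin.last n := fun h => hl (h ▸ hj)
      exact Finset.mem_map.2 ⟨j.castPred hne, mem_univ _, by simp⟩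
  exact DFunLike.congr_fun this p

lemma level_ext (N : ℕ) (z : Π n : ℕ, MvPolynomial (Fin m × Fin n) ℤ)
    (hinv : ∀ n, z n ∈ invAlg ℤ m n) (hproj : ∀ n, projDown ℤ m n (z (n + 1)) = z n)
    (hdeg : ∀ n, ∀ d ∈ (z n).support, tdeg d ≤ N) (hN : z N = 0) (n : ℕ) : z n = 0 := by
  have down : ∀ j n, z (n + j) = 0 → z n = 0 := by
    intro j
    induction j with
    | zero => intro n h; exact h
    | succ j ih =>
      intro n h
      apply ih
      have h' : z (n + j + 1) = 0 := h
      rw [← hproj, h', map_zero]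
  have up : ∀ j, z (N + j) = 0 := by
    intro j
    induction j with
    | zero => exact hN
    | succ j ih =>
      change z (N + j + 1) = 0
      by_contra hne
      obtain ⟨d, hd⟩ := MvPolynomial.support_nonempty.2 hne
      have hdN := hdeg _ d hd
      obtain ⟨j0, hj0⟩ : ∃ j0 : Fin (N + j + 1), ∀ i, d (i, j0) = 0 := by
        by_contra hno
        push Not at hno
        have : ∑ j0 : Fin (N + j + 1), 1 ≤ tdeg d := by
          refine Finset.sum_le_sum fun j0 _ => ?_
          obtain ⟨i, hi⟩ := hno j0
          exact (Nat.one_le_iff_ne_zero.2 hi).trans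
            (Finset.single_le_sum (f := fun i => d (i, j0)) (fun _ _ => Nat.zero_le _) (mem_univ i))
        simp at this
        omega
      let σ : Equiv.Perm (Fin (N + j + 1)) := Equiv.swap j0 (Fin.last (N + j))
      let d' : Fin m × Fin (N + j + 1) →₀ ℕ :=
        Finsupp.equivFunOnFinite.symm fun q => d (q.1, σ q.2)
      have hd' : ∀ i j, d' (i, σ j) = d (i, j) := by
        intro i l
        simp [d', σ]
      let d'' : Fin m × Fin (N + j) →₀ ℕ :=
        Finsupp.equivFunOnFinite.symm fun q => d' (q.1, q.2.castSucc)
      have hd'' : d''.mapDomain (fun q : Fin m × Fin (N + j) =>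
          ((q.1, q.2.castSucc) : Fin m × Fin (N + j + 1))) = d' := by
        ext ⟨i, l⟩
        induction l using Fin.lastCases with
        | last =>
          rw [Finsupp.mapDomain_of_notMem_range]
          · simp [d', σ, hj0]
          · rintro ⟨⟨a, b⟩, h⟩
            simp only [Prod.mk.injEq] at h
            exact (Fin.castSucc_lt_last b).ne h.2
        | cast l =>
          rw [Finsupp.mapDomain_apply (castS_inj m (N + j)) d'' (i, l)]
          rfl
      have h1 : coeff d (z (N + j + 1)) = 0 := by
        rw [coeff_perm _ (hinv _) d d' σ hd', ← hd'', ← coeff_projDown, hproj, ih, coeff_zero]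
      exact (MvPolynomial.mem_support_iff.1 hd) h1
  rcases le_total n N with h | h
  · obtain ⟨j, rfl⟩ := Nat.exists_eq_add_of_le h
    exact down j n hN
  · obtain ⟨j, rfl⟩ := Nat.exists_eq_add_of_le h
    exact up j

lemma list_prod_getD {M : Type*} [CommMonoid M] (F : ℕ → M) (hF : F 0 = 1) (L : List ℕ) :
    ∀ T, L.length ≤ T → ∏ t : Fin T, F (L.getD t 0) = (L.map F).prod := by
  induction L with
  | nil => intro T _; simp [hF]
  | cons a L ih =>
    intro T hT
    obtain ⟨T, rfl⟩ : ∃ T', T = T' + 1 := ⟨T - 1, by simp at hT; omega⟩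
    rw [Fin.prod_univ_succ]
    simp only [List.map_cons, List.prod_cons]
    rw [← ih T (by simpa using hT)]
    simp

lemma list_anti (L : List ℕ) (h : L.Pairwise (· ≥ ·)) : Antitone fun t => L.getD t 0 := by
  intro i j hij
  simp only
  by_cases hj : j < L.length
  · rw [List.getD_eq_getElem _ _ hj, List.getD_eq_getElem _ _ (lt_of_le_of_lt hij hj)]
    rcases hij.lt_or_eq with h' | h'
    · exact (List.pairwise_iff_getElem.1 h) i j _ _ h'
    · subst h'; exact le_rfl
  · rw [List.getD_eq_default _ _ (not_lt.1 hj)]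
    exact Nat.zero_le _

def prM (g : GenM m) : PrimM m := ⟨g.1.2, g.2.2⟩

lemma Xg_gen (g : GenM m) : Xg g.1.1 (prM g) = X g := by
  rw [Xg, dif_pos g.2.1]
  rfl

lemma mono_exists (c : GenM m →₀ ℕ) : ∃ k : PrimM m → ℕ → ℕ, (∀ μ, Antitone (k μ)) ∧
    ∃ (S0 : Finset (PrimM m)) (T0 : ℕ), ∀ S T, S0 ⊆ S → T0 ≤ T → Mk S T k = monomial c 1 := by
  let s : PrimM m → Multiset ℕ := fun μ => ∑ g ∈ c.support with prM g = μ, c g • {g.1.1}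
  refine ⟨fun μ t => ((s μ).sort (· ≥ ·)).getD t 0, fun μ => list_anti _ (Multiset.pairwise_sort _ _),
    c.support.image prM, ∑ g ∈ c.support, c g, ?_⟩
  intro S T hS hT
  rw [Mk, Fintype.prod_prod_type]
  simp only [kI, muI]
  have h1 : ∀ μ : PrimM m, ∏ t : Fin T, Xg (((s μ).sort (· ≥ ·)).getD t 0) μ =
      ∏ g ∈ c.support with prM g = μ, X g ^ c g := by
    intro μ
    rw [list_prod_getD (fun i => Xg i μ) (by simp [Xg])]
    · rw [← Multiset.prod_coe, ← Multiset.map_coe, Multiset.sort_eq]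
      have hms : Multiset.map (fun i => Xg i μ) (s μ) =
          ∑ g ∈ c.support with prM g = μ, Multiset.map (fun i => Xg i μ) (c g • {g.1.1}) :=
        map_sum (Multiset.mapAddMonoidHom fun i => Xg i μ) _ _
      rw [hms]
      simp only [Multiset.prod_sum, Multiset.map_nsmul, Multiset.prod_nsmul,
        Multiset.map_singleton, Multiset.prod_singleton]
      refine Finset.prod_congr rfl fun g hg => ?_
      rw [← (mem_filter.1 hg).2, Xg_gen]
    · rw [Multiset.length_sort]
      refine le_trans ?_ hT
      simp only [s, Multiset.card_sum, Multiset.card_nsmul, Multiset.card_singleton, mul_one]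
      exact Finset.sum_le_sum_of_subset (filter_subset _ _)
  simp only [h1]
  rw [Finset.prod_coe_sort S (fun μ => ∏ g ∈ c.support with prM g = μ, (X g ^ c g : MvPolynomial (GenM m) ℤ)),
    Finset.prod_fiberwise_of_maps_to (fun g hg => hS (mem_image_of_mem _ hg)), monomial_eq]
  simp [Finsupp.prod]

lemma nice_exists (S : Finset (PrimM m)) (T : ℕ) (k : PrimM m → ℕ → ℕ) (hk : ∀ μ, Antitone (k μ)) :
    ∃ (n : ℕ) (B : Idx S T → Finset (Fin n)), (∀ q, #(B q) = kI S T k q) ∧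
      Nice1 (muI S T) B ∧ Nice2 (muI S T) B := by
  let K := S.sup fun μ => k μ 0
  have hK : ∀ q : Idx S T, kI S T k q ≤ K := fun q =>
    (hk q.1.1 (Nat.zero_le _)).trans (Finset.le_sup (f := fun μ => k μ 0) q.1.2)
  let e : (S × Fin K) ≃ Fin (Fintype.card (S × Fin K)) := Fintype.equivFin _
  refine ⟨_, fun q => univ.image fun r : Fin (kI S T k q) => e (q.1, Fin.castLE (hK q) r), ?_, ?_, ?_⟩
  · intro q
    rw [Finset.card_image_of_injective]
    · simp
    · intro r r' h
      simpa using h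
  · intro q q' j h h'
    obtain ⟨r, _, hr⟩ := Finset.mem_image.1 h
    obtain ⟨r', _, hr'⟩ := Finset.mem_image.1 h'
    have := e.injective (hr.trans hr'.symm)
    simp only [muI]
    rw [(Prod.ext_iff.1 this).1]
  · have key : ∀ q q' : Idx S T, muI S T q = muI S T q' → kI S T k q ≤ kI S T k q' →
        (univ.image fun r : Fin (kI S T k q) => e (q.1, Fin.castLE (hK q) r)) ⊆
        (univ.image fun r : Fin (kI S T k q') => e (q'.1, Fin.castLE (hK q') r)) := by
      intro q q' hq hle j hj
      obtain ⟨r, _, hr⟩ := Finset.mem_image.1 hj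
      have hq1 : q.1 = q'.1 := Subtype.ext hq
      refine Finset.mem_image.2 ⟨Fin.castLE hle r, mem_univ _, ?_⟩
      rw [← hr, hq1]
      rfl
    intro q q' hq
    rcases le_total (kI S T k q) (kI S T k q') with h | h
    · exact Or.inl (key q q' hq h)
    · exact Or.inr (key q' q hq.symm h)

lemma ev_inj (p : MvPolynomial (GenM m) ℤ) (hp : ∀ n, ev m n p = 0) : p = 0 := by
  by_contra hne
  choose k hk S0 T0 hM using mono_exists (m := m)
  let S := p.support.sup S0
  let T := p.support.sup T0
  have hM' : ∀ c ∈ p.support, Mk S T (k c) = monomial c 1 := fun c hc =>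
    hM c S T (Finset.le_sup (f := S0) hc) (Finset.le_sup (f := T0) hc)
  obtain ⟨c0, hc0, hmax⟩ := Finset.exists_max_image p.support
    (fun c => keyk (muI S T) (kI S T (k c))) (MvPolynomial.support_nonempty.2 hne)
  obtain ⟨n, B, hB, h1, h2⟩ := nice_exists S T (k c0) (hk c0)
  have hkey := (key_eq_iff _ _ B hB).2 ⟨h1, h2⟩
  set d := dB (muI S T) B with hd
  have hcoef : coeff d (ev m n (Mk S T (k c0))) ≠ 0 := by
    rw [ev_Mk, coeff_sum]
    apply ne_of_gt
    refine Finset.sum_pos' (fun B' _ => ?_) ⟨B, ?_, ?_⟩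
    · rw [coeff_monomial]; split_ifs <;> simp
    · rw [Fintype.mem_piFinset]
      exact fun q => mem_powersetCard.2 ⟨subset_univ _, hB q⟩
    · simp [hd]
  have hsum : ev m n p = ∑ c ∈ p.support, C (coeff c p) * ev m n (Mk S T (k c)) := by
    conv_lhs => rw [p.as_sum]
    rw [map_sum]
    refine Finset.sum_congr rfl fun c hc => ?_
    rw [hM' c hc]
    have : monomial c (coeff c p) = C (coeff c p) * monomial c 1 := by
      rw [C_mul_monomial, mul_one]
    rw [this, map_mul]
    congr 1
    simp [ev]
  have h0 := congrArg (coeff d) (hp n)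
  rw [hsum, coeff_sum, Finset.sum_eq_single c0] at h0
  · rw [coeff_C_mul, coeff_zero] at h0
    rcases mul_eq_zero.1 h0 with h | h
    · exact (MvPolynomial.mem_support_iff.1 hc0) h
    · exact hcoef h
  · intro c hc hcc
    rw [coeff_C_mul]
    by_contra hne'
    obtain ⟨B', hB', hd'⟩ := coeff_ev_Mk_ne (right_ne_zero_of_mul hne')
    have hle := key_le (muI S T) _ B' hB'
    have heq : keyd (dB (muI S T) B') = keyk (muI S T) (kI S T (k c)) := by
      apply le_antisymm hle
      rw [hd', hkey]
      exact hmax c hc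
    have e1 := kI_eq_of_key (hk c) B' hB' heq
    have e2 := kI_eq_of_key (hk c0) B hB hkey
    rw [hd'] at e1
    have e3 : Mk S T (k c) = Mk S T (k c0) := by
      rw [Mk, Mk, e1, e2]
    rw [hM' c hc, hM' c0 hc0] at e3
    exact hcc (monomial_left_injective one_ne_zero e3)
  · intro h; exact absurd hc0 h

lemma ev_wdeg (p : MvPolynomial (GenM m) ℤ) :
    ∃ S : Finset (Fin m → ℕ), ∀ n, ∀ d ∈ (ev m n p).support, wdeg m n d ∈ S := by
  have hadd : ∀ n (d d' : Fin m × Fin n →₀ ℕ), wdeg m n (d + d') = wdeg m n d + wdeg m n d' := by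
    intro n d d'
    funext i
    simp [wdeg, Finset.sum_add_distrib]
  induction p using MvPolynomial.induction_on with
  | C a =>
    refine ⟨{0}, fun n d hd => ?_⟩
    have : ev m n (C a) = C a := by simp [ev]
    rw [this, MvPolynomial.mem_support_iff, coeff_C] at hd
    have h0 : d = 0 := by
      by_contra h
      exact hd (if_neg fun h' => h h'.symm)
    subst h0
    rw [mem_singleton]
    funext i
    simp [wdeg]
  | add p q hp hq =>
    obtain ⟨S, hS⟩ := hp
    obtain ⟨S', hS'⟩ := hq
    refine ⟨S ∪ S', fun n d hd => ?_⟩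
    rw [map_add] at hd
    rcases mem_union.1 (MvPolynomial.support_add hd) with h | h
    · exact mem_union_left _ (hS n d h)
    · exact mem_union_right _ (hS' n d h)
  | mul_X p g hp =>
    obtain ⟨S, hS⟩ := hp
    refine ⟨S.image fun s => s + fun i => g.1.1 * g.1.2 i, fun n d hd => ?_⟩
    rw [map_mul] at hd
    obtain ⟨d1, h1, d2, h2, rfl⟩ := Finset.mem_add.1 (MvPolynomial.support_mul _ _ hd)
    refine Finset.mem_image.2 ⟨_, hS n d1 h1, ?_⟩
    rw [hadd]
    congr 1
    rw [← Xg_gen, ev_Xg, MvPolynomial.mem_support_iff, coeff_sum] at h2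
    obtain ⟨A, hA, hne⟩ := Finset.exists_ne_zero_of_sum_ne_zero h2
    have hd2 : ∑ j ∈ A, Finsupp.mapDomain (fun i => (i, j)) (prM g).1 = d2 := by
      by_contra h
      rw [coeff_monomial, if_neg h] at hne
      exact hne rfl
    funext i
    rw [← hd2, wdeg]
    simp only [Finsupp.finsetSum_apply, mapDomain_col, Finset.sum_ite_eq', ← (mem_powersetCard.1 hA).2]
    simp [prM]

lemma tdeg_wdeg {n : ℕ} (d : Fin m × Fin n →₀ ℕ) : tdeg d = ∑ i, wdeg m n d i := by
  rw [tdeg, Finset.sum_comm]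
  rfl

end final

/-- A_ℤ(∞,m) = ⊕ₐ lim← A_ℤ(n,m,a)^{Sₙ} is a polynomial ring over ℤ, freely
generated by the limits of the e_i(μ), i ≥ 1, μ primitive: the ring homomorphism
e_{i,μ} ↦ e_i(μ) is injective, and its range consists exactly of the compatible invariant
families supported in finitely many multidegrees, i.e. A_ℤ(∞,m). -/
theorem stmt19 (m : ℕ) (hm : 1 < m) :
    Function.Injective (sigmaMap m) ∧
    Set.range (sigmaMap m) =
      {x : Π n : ℕ, MvPolynomial (Fin m × Fin n) ℤ |
        (∀ n, x n ∈ invAlg ℤ m n) ∧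
        (∀ n, projDown ℤ m n (x (n + 1)) = x n) ∧
        ∃ S : Finset (Fin m → ℕ), ∀ n, ∀ d ∈ (x n).support, wdeg m n d ∈ S} := by
  constructor
  · rw [injective_iff_map_eq_zero]
    intro p hp
    apply ev_inj p
    intro n
    rw [← sigmaMap_apply, hp]
    rfl
  · ext x
    constructor
    · rintro ⟨p, rfl⟩
      refine ⟨fun n => ?_, fun n => ?_, ?_⟩
      · rw [sigmaMap_apply]; exact ev_perm n p
      · rw [sigmaMap_apply, sigmaMap_apply]; exact ev_proj n p
      · obtain ⟨S, hS⟩ := ev_wdeg p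
        refine ⟨S, fun n d hd => hS n d ?_⟩
        rwa [sigmaMap_apply] at hd
    · rintro ⟨hinv, hproj, S, hS⟩
      let N := S.sup fun a => ∑ i, a i
      have hN : ∀ n, ∀ d ∈ (x n).support, tdeg d ≤ N := by
        intro n d hd
        rw [tdeg_wdeg]
        exact Finset.le_sup (f := fun a : Fin m → ℕ => ∑ i, a i) (hS n d hd)
      obtain ⟨p, hp, hpd⟩ := surj_level' N N (x N) (hinv N) (hN N)
      refine ⟨p, ?_⟩
      funext n
      rw [sigmaMap_apply, ← sub_eq_zero]
      refine level_ext N (fun n => ev m n p - x n) (fun n => ?_) (fun n => ?_) (fun n d hd => ?_) ?_ n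
      · exact Subalgebra.sub_mem _ (ev_perm n p) (hinv n)
      · rw [map_sub, ev_proj, hproj]
      · rcases mem_union.1 (MvPolynomial.support_sub _ _ _ hd) with h | h
        · exact hpd n d h
        · exact hN n d h
      · simp only [hp, sub_self]


end
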